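/- Let γ : ℝ → ℝ² be a smooth closed unit-speed curve with period ℓ that is injective on [0, ℓ). Then for every x₀ ∈ ℝ², the limit as t₀ → 0⁺ of (4πt₀)^{−1/2} ∫₀^ℓ e^{−|γ(t)−x₀|²/(4t₀)} dt equals 1 if x₀ lies in the image of γ, and equals 0 otherwise. -/

import Mathlib

noncomputable section
open Real MeasureTheory Filter
open scoped RealInnerProductSpace Topology

abbrev E2 := EuclideanSpace ℝ (Fin 2)

lemma stmt13_aux_inj (γ : ℝ → E2) (ℓ : ℝ) (hℓ : 0 < ℓ) (hper : ∀ t, γ (t + ℓ) = γ t)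
    (hinj : Set.InjOn γ (Set.Ico 0 ℓ)) (x y : ℝ) (h : γ x = γ y) (hxy : |y - x| < ℓ) :
    x = y := by
  have hp : Function.Periodic γ ℓ := hper
  have e : ∀ z, γ (toIcoMod hℓ 0 z) = γ z := by
    intro z
    rw [toIcoMod]
    exact hp.sub_zsmul_eq _
  have h2 : toIcoMod hℓ 0 x = toIcoMod hℓ 0 y := by
    apply hinj
    · simpa using toIcoMod_mem_Ico hℓ 0 x
    · simpa using toIcoMod_mem_Ico hℓ 0 y
    · rw [e, e, h]
  obtain ⟨n, hn⟩ := (toIcoMod_eq_toIcoMod hℓ).1 h2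
  rw [hn, zsmul_eq_mul, abs_mul, abs_of_pos hℓ] at hxy
  have h3 : |(n:ℝ)| < 1 := by
    by_contra hc
    push Not at hc
    nlinarith
  have h4 : n = 0 := by
    have : |n| < 1 := by exact_mod_cast h3
    exact Int.abs_lt_one_iff.1 this
  rw [h4] at hn
  simp at hn
  linarith

lemma stmt13_aux_lim (h : ℝ → ℝ) (hc : Continuous h) (h0 : h 0 = 1) (c : ℝ) (hcpos : 0 < c)
    (a : ℝ) (ha : 0 < a) (hb : ∀ u ∈ Set.Icc (-a) a, c ≤ h u) :
    Tendsto (fun r : ℝ => ∫ v in (-a / r)..(a / r), Real.exp (-(h (r * v)) ^ 2 * v ^ 2 / 4))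
      (𝓝[>] 0) (𝓝 (√(4 * π))) := by
  have hI : ∫ v : ℝ, Real.exp (-(1/4) * v ^ 2) = √(4 * π) := by
    rw [integral_gaussian]; congr 1; ring
  rw [← hI]
  have hE : ∀ᶠ r : ℝ in 𝓝[>] 0,
      ∫ v, (Set.Ioc (-a / r) (a / r)).indicator
        (fun v => Real.exp (-(h (r * v)) ^ 2 * v ^ 2 / 4)) v
      = ∫ v in (-a / r)..(a / r), Real.exp (-(h (r * v)) ^ 2 * v ^ 2 / 4) := by
    filter_upwards [self_mem_nhdsWithin] with r hr
    have hr : 0 < r := hr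
    rw [intervalIntegral.integral_of_le, integral_indicator measurableSet_Ioc]
    gcongr
    linarith
  refine Tendsto.congr' hE ?_
  apply tendsto_integral_filter_of_dominated_convergence
    (fun v => Real.exp (-(c ^ 2 / 4) * v ^ 2))
  · refine Eventually.of_forall fun r => ?_
    refine AEStronglyMeasurable.indicator ?_ measurableSet_Ioc
    exact Continuous.aestronglyMeasurable (by fun_prop)
  · filter_upwards [self_mem_nhdsWithin] with r hr
    have hr : 0 < r := hr
    refine Eventually.of_forall fun v => ?_
    by_cases hv : v ∈ Set.Ioc (-a / r) (a / r)
    · rw [Set.indicator_of_mem hv, Real.norm_eq_abs, Real.abs_exp]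
      apply Real.exp_le_exp.2
      have h1 := (div_lt_iff₀ hr).1 hv.1
      have h2 := (le_div_iff₀ hr).1 hv.2
      have h3 := hb (r * v) ⟨by nlinarith, by nlinarith⟩
      have h4 : c ^ 2 ≤ (h (r * v)) ^ 2 := by gcongr
      nlinarith [mul_le_mul_of_nonneg_right h4 (sq_nonneg v)]
    · rw [Set.indicator_of_notMem hv]
      simp [Real.exp_nonneg]
  · exact integrable_exp_neg_mul_sq (by positivity)
  · refine Eventually.of_forall fun v => ?_
    have ht : Tendsto (fun r : ℝ => Real.exp (-(h (r * v)) ^ 2 * v ^ 2 / 4)) (𝓝[>] 0)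
        (𝓝 (Real.exp (-(1/4) * v ^ 2))) := by
      have hcont : Continuous (fun r : ℝ => Real.exp (-(h (r * v)) ^ 2 * v ^ 2 / 4)) := by
        fun_prop
      have := (hcont.tendsto 0).mono_left (nhdsWithin_le_nhds (s := Set.Ioi (0:ℝ)))
      convert this using 2
      simp [h0]
      ring
    refine ht.congr' ?_
    have hd : Tendsto (fun r : ℝ => r * |v|) (𝓝[>] 0) (𝓝 0) := by
      have hcont : Continuous (fun r : ℝ => r * |v|) := by fun_prop
      have := (hcont.tendsto 0).mono_left (nhdsWithin_le_nhds (s := Set.Ioi (0:ℝ)))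
      simpa using this
    filter_upwards [self_mem_nhdsWithin, hd.eventually (gt_mem_nhds ha)] with r hr hra
    have hr : 0 < r := hr
    rw [Set.indicator_of_mem]
    refine ⟨(div_lt_iff₀ hr).2 ?_, (le_div_iff₀ hr).2 ?_⟩
    · nlinarith [neg_abs_le v]
    · nlinarith [le_abs_self v]

lemma stmt13_aux_on (γ : ℝ → E2) (hγ : ContDiff ℝ (⊤ : ℕ∞) γ)
    (hunit : ∀ t, ‖deriv γ t‖ = 1)
    (ℓ : ℝ) (hℓ : 0 < ℓ) (hper : ∀ t, γ (t + ℓ) = γ t)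
    (hinj : Set.InjOn γ (Set.Ico 0 ℓ)) (s : ℝ) :
    Tendsto (fun t₀ : ℝ => (4 * π * t₀) ^ (-(1:ℝ)/2) *
          ∫ t in (0:ℝ)..ℓ, Real.exp (-‖γ t - γ s‖ ^ 2 / (4 * t₀)))
        (𝓝[>] 0) (𝓝 1) := by
  have hdiff : Differentiable ℝ γ := hγ.differentiable (by simp)
  set h : ℝ → ℝ := fun u => ‖dslope γ s (s + u)‖ with hh
  have hds : Continuous (dslope γ s) := by
    rw [← continuousOn_univ]
    exact (continuousOn_dslope Filter.univ_mem).2 ⟨hdiff.continuous.continuousOn, hdiff s⟩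
  have hc : Continuous h := by fun_prop
  have h0 : h 0 = 1 := by simp [hh, hunit]
  have hg : ∀ u, ‖γ (s + u) - γ s‖ ^ 2 = (h u) ^ 2 * u ^ 2 := by
    intro u
    have := sub_smul_dslope γ s (s + u)
    rw [← this, norm_smul, Real.norm_eq_abs, mul_pow, sq_abs]
    simp only [hh]
    ring
  obtain ⟨c, hcpos, hb⟩ : ∃ c, 0 < c ∧ ∀ u ∈ Set.Icc (-(ℓ/2)) (ℓ/2), c ≤ h u := by
    obtain ⟨u₀, hu₀, hmin⟩ := (isCompact_Icc (a := -(ℓ/2)) (b := ℓ/2)).exists_isMinOn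
      ⟨0, by constructor <;> linarith⟩ hc.continuousOn
    refine ⟨h u₀, ?_, fun u hu => hmin hu⟩
    by_cases hz : u₀ = 0
    · rw [hz, h0]; norm_num
    · apply (norm_nonneg _).lt_of_ne'
      intro hzero
      have h1 : h u₀ = 0 := hzero
      have h2 := hg u₀
      rw [h1] at h2
      have h3 : γ (s + u₀) = γ s := by
        rw [← sub_eq_zero, ← norm_eq_zero]
        simpa using h2
      have h4 := stmt13_aux_inj γ ℓ hℓ hper hinj _ _ h3 (by
        rw [abs_lt]; constructor <;> linarith [hu₀.1, hu₀.2])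
      exact hz (by linarith)
  have hlim := stmt13_aux_lim h hc h0 c hcpos (ℓ/2) (by linarith) hb
  have hsq : Tendsto (fun t : ℝ => √t) (𝓝[>] 0) (𝓝[>] 0) := by
    apply tendsto_nhdsWithin_iff.2
    refine ⟨?_, ?_⟩
    · have := (Real.continuous_sqrt.tendsto 0).mono_left
        (nhdsWithin_le_nhds (s := Set.Ioi (0:ℝ)))
      simpa using this
    · filter_upwards [self_mem_nhdsWithin] with t ht
      exact Real.sqrt_pos.2 ht
  have hfin := (hlim.comp hsq).const_mul ((√(4 * π))⁻¹)
  have hpi : √(4 * π) ≠ 0 := by positivity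
  rw [inv_mul_cancel₀ hpi] at hfin
  refine hfin.congr' ?_
  filter_upwards [self_mem_nhdsWithin] with t ht
  have ht : 0 < t := ht
  have hr : 0 < √t := Real.sqrt_pos.2 ht
  simp only [Function.comp]
  have e1 : ∫ x in (0:ℝ)..ℓ, Real.exp (-‖γ x - γ s‖ ^ 2 / (4 * t))
      = ∫ u in (-(ℓ/2))..(ℓ/2), Real.exp (-‖γ (s + u) - γ s‖ ^ 2 / (4 * t)) := by
    have hp : Function.Periodic (fun x => Real.exp (-‖γ x - γ s‖ ^ 2 / (4 * t))) ℓ := by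
      intro x; simp only [hper]
    have := hp.intervalIntegral_add_eq 0 (s - ℓ/2)
    rw [zero_add] at this
    rw [this, intervalIntegral.integral_comp_add_left
      (fun x => Real.exp (-‖γ x - γ s‖ ^ 2 / (4 * t)))]
    congr 1 <;> ring
  have e2 : ∫ v in (-(ℓ/2) / √t)..((ℓ/2) / √t), Real.exp (-(h (√t * v)) ^ 2 * v ^ 2 / 4)
      = (√t)⁻¹ * ∫ u in (-(ℓ/2))..(ℓ/2), Real.exp (-‖γ (s + u) - γ s‖ ^ 2 / (4 * t)) := by
    have := intervalIntegral.integral_comp_mul_left (a := -(ℓ/2) / √t) (b := (ℓ/2) / √t)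
      (fun u => Real.exp (-‖γ (s + u) - γ s‖ ^ 2 / (4 * t))) hr.ne'
    rw [mul_div_cancel₀ _ hr.ne', mul_div_cancel₀ _ hr.ne', smul_eq_mul] at this
    rw [← this]
    congr 1
    ext v
    rw [hg, mul_pow, Real.sq_sqrt ht.le]
    congr 1
    field_simp
  have e3 : (4 * π * t) ^ (-(1:ℝ)/2) = (√(4 * π))⁻¹ * (√t)⁻¹ := by
    rw [neg_div, Real.rpow_neg (by positivity), ← Real.sqrt_eq_rpow,
      Real.sqrt_mul (by positivity), mul_inv]
  rw [e1, e2, e3, mul_assoc]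

lemma stmt13_aux_off (γ : ℝ → E2) (hγ : Continuous γ)
    (ℓ : ℝ) (hℓ : 0 < ℓ) (x₀ : E2) (hx : x₀ ∉ Set.range γ) :
    Tendsto (fun t₀ : ℝ => (4 * π * t₀) ^ (-(1:ℝ)/2) *
          ∫ t in (0:ℝ)..ℓ, Real.exp (-‖γ t - x₀‖ ^ 2 / (4 * t₀)))
        (𝓝[>] 0) (𝓝 0) := by
  obtain ⟨d, hd, hb⟩ : ∃ d, 0 < d ∧ ∀ u ∈ Set.Icc 0 ℓ, d ≤ ‖γ u - x₀‖ := by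
    obtain ⟨u₀, hu₀, hmin⟩ := (isCompact_Icc (a := 0) (b := ℓ)).exists_isMinOn
      ⟨0, by constructor <;> linarith⟩
      (f := fun u => ‖γ u - x₀‖) (by fun_prop)
    refine ⟨‖γ u₀ - x₀‖, ?_, fun u hu => hmin hu⟩
    rw [norm_pos_iff, sub_ne_zero]
    intro h; exact hx ⟨u₀, h⟩
  have hT := (((tendsto_rpow_mul_exp_neg_mul_atTop_nhds_zero (1/2) (d ^ 2 / 4)
    (by positivity)).comp tendsto_inv_nhdsGT_zero).const_mul ((√(4 * π))⁻¹ * ℓ))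
  rw [mul_zero] at hT
  refine squeeze_zero' ?_ ?_ hT
  · filter_upwards [self_mem_nhdsWithin] with t ht
    have ht : 0 < t := ht
    refine mul_nonneg (by positivity) ?_
    exact intervalIntegral.integral_nonneg hℓ.le fun u _ => (Real.exp_pos _).le
  · filter_upwards [self_mem_nhdsWithin] with t ht
    have ht : 0 < t := ht
    have e3 : (4 * π * t) ^ (-(1:ℝ)/2) = (√(4 * π))⁻¹ * (√t)⁻¹ := by
      rw [neg_div, Real.rpow_neg (by positivity), ← Real.sqrt_eq_rpow,
        Real.sqrt_mul (by positivity), mul_inv]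
    have hI : ∫ u in (0:ℝ)..ℓ, Real.exp (-‖γ u - x₀‖ ^ 2 / (4 * t))
        ≤ ∫ u in (0:ℝ)..ℓ, Real.exp (-(d ^ 2 / 4) * t⁻¹) := by
      apply intervalIntegral.integral_mono_on hℓ.le
      · exact Continuous.intervalIntegrable (by fun_prop) _ _
      · exact Continuous.intervalIntegrable (by fun_prop) _ _
      · intro u hu
        apply Real.exp_le_exp.2
        have h1 : d ^ 2 ≤ ‖γ u - x₀‖ ^ 2 := by
          have := hb u hu
          gcongr
        have h2 : -(d ^ 2 / 4) * t⁻¹ = -d ^ 2 / (4 * t) := by field_simp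
        rw [h2]
        gcongr
    rw [intervalIntegral.integral_const, smul_eq_mul, sub_zero] at hI
    rw [e3]
    simp only [Function.comp]
    rw [← Real.sqrt_eq_rpow, Real.sqrt_inv]
    calc _ ≤ (√(4 * π))⁻¹ * (√t)⁻¹ * (ℓ * Real.exp (-(d ^ 2 / 4) * t⁻¹)) := by gcongr
      _ = _ := by ring

/-- For a smooth closed embedded unit-speed curve in the plane,
`F_{x₀,t₀}(γ) → 1` as `t₀ → 0⁺` if `x₀` lies on the curve, and `F_{x₀,t₀}(γ) → 0`
otherwise. -/
theorem stmt13 (γ : ℝ → E2) (hγ : ContDiff ℝ (⊤ : ℕ∞) γ)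
    (hunit : ∀ t, ‖deriv γ t‖ = 1)
    (ℓ : ℝ) (hℓ : 0 < ℓ) (hper : ∀ t, γ (t + ℓ) = γ t)
    (hinj : Set.InjOn γ (Set.Ico 0 ℓ)) (x₀ : E2) :
    (x₀ ∈ Set.range γ →
      Tendsto (fun t₀ : ℝ => (4 * π * t₀) ^ (-(1:ℝ)/2) *
          ∫ t in (0:ℝ)..ℓ, Real.exp (-‖γ t - x₀‖ ^ 2 / (4 * t₀)))
        (𝓝[>] 0) (𝓝 1)) ∧
    (x₀ ∉ Set.range γ →
      Tendsto (fun t₀ : ℝ => (4 * π * t₀) ^ (-(1:ℝ)/2) *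
          ∫ t in (0:ℝ)..ℓ, Real.exp (-‖γ t - x₀‖ ^ 2 / (4 * t₀)))
        (𝓝[>] 0) (𝓝 0)) := by
  refine ⟨?_, fun hx => stmt13_aux_off γ hγ.continuous ℓ hℓ x₀ hx⟩
  rintro ⟨s, rfl⟩
  exact stmt13_aux_on γ hγ hunit ℓ hℓ hper hinj s
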